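/- arXiv:2308.08034 — 2 statements merged into one kernel-verified Lean document; each statement's English description precedes it below -/
import Mathlib

section
/- Fix an integer r ≥ 1 and let s, B, b_0,…,b_{2r+1}, t_1, t_2 be as defined, and set P := b_1 b_2 ⋯ b_{2r} and Q := b_2 b_3 ⋯ b_{2r−1} (with Q = 1 when r = 1). Then 2 divides 1 + P + (s_1 − 1)·t_1 and 3 divides 1 + 2(s_1 − 1)²·Q + 2(s_2 − 1)·t_2. (That is, the last two exponents b′_{2r+1} := (1 + P + (s_1−1)t_1)/2 and b′_{2r} := (1 + 2(s_1−1)²Q + 2(s_2−1)t_2)/3 of the large-index hypersurfaces of Esser–Totaro–Wang are integers.) -/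
/-- Sylvester's sequence: `s 0 = 2`, `s (j+1) = s j * (s j − 1) + 1`;
it begins 2, 3, 7, 43, 1807, …. -/
def sylv : ℕ → ℕ
  | 0 => 2
  | n + 1 => sylv n * (sylv n - 1) + 1

/-- The alternating sum `B(x₁,…,x_k) = ∑_{j=0}^{k} (−1)^{k−j} x₁⋯x_j`
(the empty product being 1), characterized by `B [] = 1` and
`B (x :: xs) = x * B xs + (−1)^(length (x :: xs))`. -/
def Bsum : List ℤ → ℤ
  | [] => 1
  | x :: xs => x * Bsum xs + (-1) ^ (xs.length + 1)

/-- `Zl r t` is the list of length `2t` formed by concatenating the pairs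
`(b_{r+u}, b_{r+1−u})` for `u = 1, …, t`, where `b` are the exponents
defined inductively together with this list. -/
def Zl (r : ℕ) : ℕ → List ℤ
  | 0 => []
  | t + 1 => Zl r t ++ [1 + ((sylv (r - t) : ℤ) - 1) ^ 2 * Bsum (Zl r t), (sylv (r - t) : ℤ)]

/-- The exponents `b_0, …, b_{2r+1}`: `b_j = s_j` for `j ≤ r`, and
`b_{r+i} = 1 + (b_{r+1−i} − 1)² · B(Z_{i−1})` for `1 ≤ i ≤ r+1`
(here, for `j = r + i`, one has `b_{r+1−i} = s_{2r+1−j}`). -/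
def bexp (r j : ℕ) : ℤ :=
  if j ≤ r then (sylv j : ℤ)
  else 1 + ((sylv (2 * r + 1 - j) : ℤ) - 1) ^ 2 * Bsum (Zl r (j - r - 1))

/-- The list `L_k = (b_{r+1}, b_r, b_{r+2}, b_{r−1}, …, b_{2r+1−k}, b_k)`,
formed by concatenating the pairs `(b_{r+t}, b_{r+1−t})` for `t = 1, …, r+1−k`. -/
def Lk (r k : ℕ) : List ℤ := Zl r (r + 1 - k)

/-- `t_k := B(L_k)`. -/
def tB (r k : ℕ) : ℤ := Bsum (Lk r k)

/-- `g_k := B(reverse of L_k)`. -/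
def gB (r k : ℕ) : ℤ := Bsum (Lk r k).reverse

/-- `T_k`: the alternating sum of `B` over the suffixes of `L_k`
(the full list with sign `+`, the empty suffix contributing `+1`). -/
def TB (r k : ℕ) : ℤ :=
  ∑ m ∈ Finset.range ((Lk r k).length + 1), (-1) ^ m * Bsum ((Lk r k).drop m)

/-- `w_k := (s_k − 1)·T_k − 1`. -/
def wB (r k : ℕ) : ℤ := ((sylv k : ℤ) - 1) * TB r k - 1

theorem sylv_pos (n : ℕ) : 1 ≤ sylv n := by
  cases n with
  | zero => simp [sylv]
  | succ n => simp [sylv]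

theorem sylv_succ_sub_one (n : ℕ) :
    (sylv (n + 1) : ℤ) - 1 = sylv n * ((sylv n : ℤ) - 1) := by
  simp [sylv, Nat.cast_sub (sylv_pos n)]

theorem sylv_dvd_sylv_sub_one {k n : ℕ} (h : k < n) : (sylv k : ℤ) ∣ (sylv n : ℤ) - 1 := by
  induction n, h using Nat.le_induction with
  | base => exact sylv_succ_sub_one k ▸ dvd_mul_right _ _
  | succ n _ ih => exact sylv_succ_sub_one n ▸ ih.mul_left _

theorem bexp_modEq_one {r k j : ℕ} (hkj : k < j) (hj : j + k ≤ 2 * r) :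
    bexp r j ≡ 1 [ZMOD sylv k] := by
  refine (Int.modEq_iff_dvd.mpr ?_).symm
  unfold bexp
  split_ifs with h
  · exact sylv_dvd_sylv_sub_one hkj
  · rw [add_sub_cancel_left]
    exact (dvd_pow (sylv_dvd_sylv_sub_one (by lia)) two_ne_zero).mul_right _

theorem prod_bexp_modEq_one (r k : ℕ) :
    ∏ j ∈ Finset.Icc (k + 1) (2 * r - k), bexp r j ≡ 1 [ZMOD sylv k] := by
  refine Finset.prod_induction _ (· ≡ 1 [ZMOD sylv k])
    (fun a b ha hb => by simpa using ha.mul hb) rfl fun j hj => ?_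
  rw [Finset.mem_Icc] at hj
  exact bexp_modEq_one (by lia) (by lia)

/-- Integrality of the last two exponents `b′_{2r+1}` and `b′_{2r}` of the
large-index hypersurfaces of Esser–Totaro–Wang:
`2 ∣ 1 + b_1⋯b_{2r} + (s_1 − 1)·t_1` and
`3 ∣ 1 + 2(s_1 − 1)²·b_2⋯b_{2r−1} + 2(s_2 − 1)·t_2`. -/
theorem large_index_exponents_integral (r : ℕ) (hr : 1 ≤ r) :
    (2 ∣ 1 + (∏ j ∈ Finset.Icc 1 (2 * r), bexp r j) + ((sylv 1 : ℤ) - 1) * tB r 1) ∧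
    (3 ∣ 1 + 2 * ((sylv 1 : ℤ) - 1) ^ 2 * (∏ j ∈ Finset.Icc 2 (2 * r - 1), bexp r j) +
      2 * ((sylv 2 : ℤ) - 1) * tB r 2) := by
  have hP := prod_bexp_modEq_one r 0
  have hQ := prod_bexp_modEq_one r 1
  simp only [Int.ModEq, sylv, zero_add, Nat.sub_zero, Nat.reduceAdd, Nat.reduceMul,
    Nat.reduceSub, Nat.cast_ofNat] at hP hQ ⊢
  constructor <;> lia
end

section
/- Fix an integer r ≥ 1 and let s, B, b_0,…,b_{2r+1}, t_1, g_1, w_1 be as defined; set P := b_1 b_2 ⋯ b_{2r}, let b′ be the integer with 2·b′ = 1 + P + 2·t_1, and set v′ := g_1 + w_1. Let A be the (2r+3)×(2r+3) matrix with rational entries, with rows and columns indexed by 0, 1, …, 2r+2, whose entries are: A_{i,i} = b_i for 0 ≤ i ≤ 2r, A_{2r+1,2r+1} = b′, A_{2r+2,2r+2} = v′; A_{i,2r+2−i} = 1 for 0 ≤ i ≤ r; A_{r+1+i,r−i} = 1 for 0 ≤ i ≤ r; A_{2r+2,r+1} = 1; and all other entries 0. Then A is invertible over ℚ and the sum of all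 (2r+3)² entries of A⁻¹ equals 1. (This is the odd-dimensional case of Lemma 7.1: the large-index hypersurface V′ of dimension n = 2r+1 is Calabi–Yau.) -/
theorem two_le_sylv (n : ℕ) : (2 : ℤ) ≤ sylv n := by
  suffices h : 2 ≤ sylv n by exact_mod_cast h
  induction n with
  | zero => simp [sylv]
  | succ n ih =>
    have h : 1 ≤ sylv n - 1 := by omega
    have := Nat.mul_le_mul ih h
    simp only [sylv]
    omega

theorem sylv_succ_cast (n : ℕ) : (sylv (n + 1) : ℤ) = sylv n * (sylv n - 1) + 1 := by
  have h : 1 ≤ sylv n := by exact_mod_cast (by norm_num : (1 : ℤ) ≤ 2).trans (two_le_sylv n)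
  simp [sylv, Nat.cast_sub h]

theorem Bsum_append_singleton (l : List ℤ) (x : ℤ) :
    Bsum (l ++ [x]) = l.prod * x - Bsum l := by
  induction l with
  | nil => simp [Bsum]; ring
  | cons y l ih =>
    simp only [List.cons_append, Bsum, ih, List.length_append, List.length_singleton,
      List.prod_cons, pow_succ]
    ring

/-- The alternating sum of `Bsum` over the suffixes of a list. -/
def suffixAltSum (l : List ℤ) : ℤ :=
  ∑ m ∈ Finset.range (l.length + 1), (-1) ^ m * Bsum (l.drop m)

theorem suffixAltSum_cons (y : ℤ) (l : List ℤ) :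
    suffixAltSum (y :: l) = Bsum (y :: l) - suffixAltSum l := by
  simp only [suffixAltSum, List.length_cons]
  rw [Finset.sum_range_succ']
  simp only [List.drop_succ_cons, pow_succ, List.drop_zero, pow_zero, one_mul, mul_neg, mul_one,
    neg_mul, Finset.sum_neg_distrib]
  ring

theorem suffixAltSum_append_singleton (l : List ℤ) (x : ℤ) :
    suffixAltSum (l ++ [x]) =
      x * Bsum l.reverse - suffixAltSum l + (-1) ^ (l.length + 1) := by
  induction l with
  | nil => simp [suffixAltSum, Bsum, Finset.sum_range_succ]; ring
  | cons y l ih =>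
    rw [List.cons_append, suffixAltSum_cons, suffixAltSum_cons, ih, ← List.cons_append,
      Bsum_append_singleton, List.reverse_cons, Bsum_append_singleton]
    simp only [List.prod_cons, List.prod_reverse, List.length_cons, pow_succ]
    ring

theorem Zl_length (r t : ℕ) : (Zl r t).length = 2 * t := by
  induction t with
  | zero => rfl
  | succ t ih => simp [Zl, ih]; ring

theorem bexp_of_le {r j : ℕ} (h : j ≤ r) : bexp r j = sylv j := if_pos h

theorem bexp_add (r u : ℕ) :
    bexp r (r + 1 + u) = 1 + ((sylv (r - u) : ℤ) - 1) ^ 2 * Bsum (Zl r u) := by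
  rw [bexp, if_neg (by omega), show 2 * r + 1 - (r + 1 + u) = r - u by omega,
    show r + 1 + u - r - 1 = u by omega]

theorem Zl_succ (r t : ℕ) :
    Zl r (t + 1) = (Zl r t ++ [bexp r (r + 1 + t)]) ++ [(sylv (r - t) : ℤ)] := by
  simp [Zl, bexp_add]

theorem prod_Zl_succ (r t : ℕ) :
    (Zl r (t + 1)).prod = (Zl r t).prod * bexp r (r + 1 + t) * sylv (r - t) := by
  simp [Zl_succ, mul_assoc]

theorem Bsum_Zl_succ (r t : ℕ) :
    Bsum (Zl r (t + 1)) =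
      (Zl r t).prod * bexp r (r + 1 + t) * (sylv (r - t) - 1) + Bsum (Zl r t) := by
  rw [Zl_succ, Bsum_append_singleton, Bsum_append_singleton, List.prod_append]
  simp only [List.prod_singleton]
  ring

theorem Bsum_reverse_Zl_succ (r t : ℕ) :
    Bsum (Zl r (t + 1)).reverse =
      sylv (r - t) * (bexp r (r + 1 + t) * Bsum (Zl r t).reverse - 1) + 1 := by
  have h : (-1 : ℤ) ^ (2 * t) = 1 := by simp [pow_mul]
  simp only [Zl_succ, List.reverse_append, List.reverse_singleton, List.singleton_append, Bsum,
    List.length_cons, List.length_reverse, Zl_length, pow_succ, h]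
  ring

theorem suffixAltSum_Zl_succ (r t : ℕ) :
    suffixAltSum (Zl r (t + 1)) =
      bexp r (r + 1 + t) * (sylv (r - t) - 1) * Bsum (Zl r t).reverse + suffixAltSum (Zl r t)
        - (sylv (r - t) - 1) + 1 := by
  rw [Zl_succ, suffixAltSum_append_singleton, suffixAltSum_append_singleton]
  simp [Bsum, Zl_length, pow_succ, pow_mul]
  ring

theorem one_le_Zl_invariants (r t : ℕ) :
    1 ≤ (Zl r t).prod ∧ 1 ≤ Bsum (Zl r t) ∧ 1 ≤ Bsum (Zl r t).reverse ∧
      1 ≤ suffixAltSum (Zl r t) := by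
  induction t with
  | zero => simp [Zl, Bsum, suffixAltSum]
  | succ t ih =>
    obtain ⟨hP, hB, hg, hT⟩ := ih
    have hc := two_le_sylv (r - t)
    have hx : 2 ≤ bexp r (r + 1 + t) := by
      rw [bexp_add]
      nlinarith [mul_le_mul (show (1 : ℤ) ≤ (sylv (r - t) - 1) ^ 2 by nlinarith) hB
        zero_le_one (by positivity)]
    rw [prod_Zl_succ, Bsum_Zl_succ, Bsum_reverse_Zl_succ, suffixAltSum_Zl_succ]
    have hxg : 2 ≤ bexp r (r + 1 + t) * Bsum (Zl r t).reverse := by nlinarith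
    have hPx : 2 ≤ (Zl r t).prod * bexp r (r + 1 + t) := by nlinarith
    refine ⟨?_, ?_, ?_, ?_⟩ <;> nlinarith

theorem two_le_bexp (r j : ℕ) : 2 ≤ bexp r j := by
  by_cases h : j ≤ r
  · rw [bexp_of_le h]
    exact two_le_sylv j
  · obtain ⟨u, rfl⟩ := Nat.exists_eq_add_of_le (show r + 1 ≤ j by omega)
    rw [bexp_add]
    have hc := two_le_sylv (r - u)
    nlinarith [mul_le_mul (show (1 : ℤ) ≤ (sylv (r - u) - 1) ^ 2 by nlinarith)
      (one_le_Zl_invariants r u).2.1 zero_le_one (by positivity)]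

theorem sylv_sub_one_mul_Bsum_mul_Bsum_reverse (r t : ℕ) (ht : t ≤ r) :
    ((sylv (r + 1 - t) : ℤ) - 1) * Bsum (Zl r t) * Bsum (Zl r t).reverse -
      (Zl r t).prod * ((sylv (r + 1 - t) - 1) * suffixAltSum (Zl r t) - 1) = 1 := by
  induction t with
  | zero => simp [Zl, Bsum, suffixAltSum]
  | succ t ih =>
    have ih := ih (by omega)
    rw [show r + 1 - t = (r - t) + 1 by omega, sylv_succ_cast] at ih
    rw [show r + 1 - (t + 1) = r - t by omega, prod_Zl_succ, Bsum_Zl_succ,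
      Bsum_reverse_Zl_succ, suffixAltSum_Zl_succ]
    linear_combination bexp r (r + 1 + t) * ih + bexp_add r t

/-- The weights of the variables with indices `r + 1, …, 2r + 1` in degree `D`,
starting from `e`. -/
def upperWeight (r : ℕ) (D e : ℤ) : ℕ → ℤ
  | 0 => e
  | t + 1 => D - sylv (r - t) * (D - bexp r (r + 1 + t) * upperWeight r D e t)

theorem upperWeight_eq (r : ℕ) (D e : ℤ) (t : ℕ) :
    upperWeight r D e t =
      D * (Bsum (Zl r t).reverse - (Zl r t).prod) + (Zl r t).prod * e := by
  induction t with
  | zero => simp [upperWeight, Zl, Bsum]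
  | succ t ih =>
    rw [upperWeight, ih, prod_Zl_succ, Bsum_reverse_Zl_succ]
    ring

theorem prod_mul_sylv_sub_one_mul_sum_weights (r : ℕ) (D e : ℤ) (t : ℕ) (ht : t ≤ r) :
    (Zl r t).prod * (sylv (r + 1 - t) - 1) *
        ∑ u ∈ Finset.range t,
          (upperWeight r D e u + (D - bexp r (r + 1 + u) * upperWeight r D e u)) =
      ((Zl r t).prod - 1) * D +
        (sylv (r + 1 - t) - 1) * (Bsum (Zl r t) - (Zl r t).prod) * upperWeight r D e t := by
  induction t with
  | zero => simp [Zl, Bsum]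
  | succ t ih =>
    have ih := ih (by omega)
    rw [show r + 1 - t = (r - t) + 1 by omega, sylv_succ_cast] at ih
    rw [Finset.sum_range_succ, show r + 1 - (t + 1) = r - t by omega, prod_Zl_succ,
      Bsum_Zl_succ, upperWeight]
    linear_combination bexp r (r + 1 + t) * ih - D * bexp_add r t

theorem prod_range_succ_eq_prod_range_sub {M : Type*} [CommMonoid M] (f : ℕ → M) (r : ℕ) :
    ∏ j ∈ Finset.range r, f (j + 1) = ∏ u ∈ Finset.range r, f (r - u) := by
  rw [← Finset.prod_range_reflect]
  refine Finset.prod_congr rfl fun u hu => congrArg f ?_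
  have := Finset.mem_range.mp hu
  omega

theorem sum_range_succ_eq_sum_range_sub {M : Type*} [AddCommMonoid M] (f : ℕ → M) (r : ℕ) :
    ∑ j ∈ Finset.range r, f (j + 1) = ∑ u ∈ Finset.range r, f (r - u) :=
  prod_range_succ_eq_prod_range_sub (M := Multiplicative M) f r

theorem prod_Zl (r t : ℕ) :
    (Zl r t).prod = ∏ u ∈ Finset.range t, (bexp r (r + 1 + u) * bexp r (r - u)) := by
  induction t with
  | zero => simp [Zl]
  | succ t ih =>
    rw [prod_Zl_succ, Finset.prod_range_succ, ih, bexp_of_le (Nat.sub_le r t), mul_assoc]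

theorem prod_Icc_bexp (r : ℕ) : ∏ j ∈ Finset.Icc 1 (2 * r), bexp r j = (Zl r r).prod := by
  have h : Finset.Icc 1 (2 * r) = Finset.Ico 1 (2 * r + 1) := by ext; simp
  rw [h, Finset.prod_Ico_eq_prod_range, show 2 * r + 1 - 1 = r + r by omega,
    Finset.prod_range_add, prod_Zl, Finset.prod_mul_distrib, mul_comm]
  simp only [add_comm 1]
  rw [prod_range_succ_eq_prod_range_sub]
  simp only [add_right_comm]

theorem sum_range_two_mul_add_three (r : ℕ) (f : ℕ → ℤ) :
    ∑ j ∈ Finset.range (2 * r + 3), f j =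
      f 0 + ∑ u ∈ Finset.range r, (f (r + 1 + u) + f (r - u)) + f (2 * r + 1) +
        f (2 * r + 2) := by
  rw [Finset.sum_range_succ, Finset.sum_range_succ, Finset.sum_range_succ', two_mul,
    Finset.sum_range_add, sum_range_succ_eq_sum_range_sub, Finset.sum_add_distrib]
  simp only [add_right_comm]
  ring

/-- The weights of the variables of the hypersurface `V′` whose last
two diagonal exponents are given. -/
def cyWeight (r : ℕ) (b' v : ℤ) (j : ℕ) : ℤ :=
  if j = 0 then b' - 1
  else if j ≤ r then
    2 * b' - 1 -
      bexp r (2 * r + 1 - j) * upperWeight r (2 * b' - 1) (2 * b' - 1 - v) (r - j)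
  else if j ≤ 2 * r + 1 then upperWeight r (2 * b' - 1) (2 * b' - 1 - v) (j - r - 1)
  else 1

theorem cyWeight_zero (r : ℕ) (b' v : ℤ) : cyWeight r b' v 0 = b' - 1 := rfl

theorem cyWeight_last (r : ℕ) (b' v : ℤ) : cyWeight r b' v (2 * r + 2) = 1 := by
  simp only [cyWeight]
  rw [if_neg (by omega), if_neg (by omega), if_neg (by omega)]

theorem cyWeight_upper {r : ℕ} (b' v : ℤ) {t : ℕ} (ht : t ≤ r) :
    cyWeight r b' v (r + 1 + t) = upperWeight r (2 * b' - 1) (2 * b' - 1 - v) t := by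
  rw [cyWeight, if_neg (by omega), if_neg (by omega), if_pos (by omega),
    show r + 1 + t - r - 1 = t by omega]

theorem cyWeight_lower {r : ℕ} (b' v : ℤ) {t : ℕ} (ht : t < r) :
    cyWeight r b' v (r - t) = 2 * b' - 1 -
      bexp r (r + 1 + t) * upperWeight r (2 * b' - 1) (2 * b' - 1 - v) t := by
  rw [cyWeight, if_neg (by omega), if_pos (by omega),
    show 2 * r + 1 - (r - t) = r + 1 + t by omega, show r - (r - t) = t by omega]

theorem TB_eq_suffixAltSum (r k : ℕ) : TB r k = suffixAltSum (Zl r (r + 1 - k)) := rfl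

/-- The column of the off-diagonal entry in row `i` of the exponent matrix. -/
def offDiagIndex (r i : ℕ) : ℕ :=
  if i ≤ r then 2 * r + 2 - i else if i ≤ 2 * r + 1 then 2 * r + 1 - i else r + 1

/-- The diagonal of the exponent matrix with the given last two entries. -/
def diagExp (r : ℕ) (b' v : ℤ) (i : ℕ) : ℤ :=
  if i ≤ 2 * r then bexp r i else if i = 2 * r + 1 then b' else v

section Weights

variable {r : ℕ} {b' : ℤ}

theorem upperWeight_last (hb : 2 * b' = 1 + (Zl r r).prod + 2 * tB r 1) (hr : 1 ≤ r) :
    upperWeight r (2 * b' - 1) (2 * b' - 1 - (gB r 1 + wB r 1)) r = 1 := by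
  have h := sylv_sub_one_mul_Bsum_mul_Bsum_reverse r r le_rfl
  have hs : (sylv 1 : ℤ) = 3 := rfl
  rw [upperWeight_eq, wB, TB_eq_suffixAltSum]
  simp only [tB, gB, Lk, show r + 1 - 1 = r by omega, show r + 1 - r = 1 by omega, hs] at *
  linear_combination h + Bsum (Zl r r).reverse * hb

theorem sum_cyWeight (hb : 2 * b' = 1 + (Zl r r).prod + 2 * tB r 1) (hr : 1 ≤ r) :
    ∑ j ∈ Finset.range (2 * r + 3), cyWeight r b' (gB r 1 + wB r 1) j = 2 * b' - 1 := by
  have hlast := upperWeight_last hb hr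
  have hsum := prod_mul_sylv_sub_one_mul_sum_weights r (2 * b' - 1)
    (2 * b' - 1 - (gB r 1 + wB r 1)) r le_rfl
  have hs : (sylv 1 : ℤ) = 3 := rfl
  have hP := (one_le_Zl_invariants r r).1
  rw [sum_range_two_mul_add_three, cyWeight_zero, cyWeight_last,
    show 2 * r + 1 = r + 1 + r by omega, cyWeight_upper _ _ le_rfl, hlast]
  rw [hlast, show r + 1 - r = 1 by omega, hs] at hsum
  rw [tB, Lk, show r + 1 - 1 = r by omega] at hb
  rw [Finset.sum_congr rfl fun u hu => by
    rw [cyWeight_upper _ _ (Finset.mem_range.mp hu).le, cyWeight_lower _ _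
      (Finset.mem_range.mp hu)]]
  refine mul_left_cancel₀ (show 2 * (Zl r r).prod ≠ 0 by positivity) ?_
  linear_combination hsum - hb

theorem diagExp_mul_cyWeight_add (hb : 2 * b' = 1 + (Zl r r).prod + 2 * tB r 1) (hr : 1 ≤ r)
    {i : ℕ} (hi : i < 2 * r + 3) :
    diagExp r b' (gB r 1 + wB r 1) i * cyWeight r b' (gB r 1 + wB r 1) i +
      cyWeight r b' (gB r 1 + wB r 1) (offDiagIndex r i) = 2 * b' - 1 := by
  have hlast := upperWeight_last hb hr
  rcases Nat.eq_zero_or_pos i with rfl | h0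
  · have hs : (sylv 0 : ℤ) = 2 := rfl
    simp only [diagExp, offDiagIndex, zero_le, if_true, Nat.sub_zero, cyWeight_zero,
      cyWeight_last, bexp, hs]
    ring
  by_cases h1 : i ≤ r
  · obtain ⟨t, ht, rfl⟩ : ∃ t, t < r ∧ i = r - t := ⟨r - i, by omega, by omega⟩
    rw [diagExp, offDiagIndex, if_pos (by omega), if_pos h1, cyWeight_lower _ _ ht,
      show 2 * r + 2 - (r - t) = r + 1 + (t + 1) by omega, cyWeight_upper _ _ ht, upperWeight,
      bexp_of_le h1]
    ring
  by_cases h2 : i ≤ 2 * r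
  · obtain ⟨t, ht, rfl⟩ : ∃ t, t < r ∧ i = r + 1 + t := ⟨i - r - 1, by omega, by omega⟩
    rw [diagExp, offDiagIndex, if_pos h2, if_neg h1, if_pos (by omega),
      show 2 * r + 1 - (r + 1 + t) = r - t by omega, cyWeight_lower _ _ ht,
      cyWeight_upper _ _ ht.le]
    ring
  by_cases h3 : i = 2 * r + 1
  · rw [diagExp, offDiagIndex, if_neg h2, if_pos h3, if_neg h1, if_pos h3.le, h3, Nat.sub_self,
      cyWeight_zero, show 2 * r + 1 = r + 1 + r by omega, cyWeight_upper _ _ le_rfl, hlast]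
    ring
  · obtain rfl : i = 2 * r + 2 := by omega
    rw [diagExp, offDiagIndex, if_neg h2, if_neg h3, if_neg h1, if_neg (by omega),
      cyWeight_last, show cyWeight r b' (gB r 1 + wB r 1) (r + 1) = _ from
        cyWeight_upper (t := 0) _ _ (Nat.zero_le r), upperWeight]
    ring

theorem two_le_diagExp (hb : 2 * b' = 1 + (Zl r r).prod + 2 * tB r 1) (i : ℕ) :
    2 ≤ diagExp r b' (gB r 1 + wB r 1) i := by
  obtain ⟨hP, hB, hg, hT⟩ := one_le_Zl_invariants r r
  have hs : (sylv 1 : ℤ) = 3 := rfl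
  rw [wB, TB_eq_suffixAltSum]
  simp only [tB, gB, Lk, show r + 1 - 1 = r by omega, hs] at *
  unfold diagExp
  split_ifs
  · exact two_le_bexp r i
  · omega
  · omega

end Weights

theorem offDiagIndex_lt {r i : ℕ} : offDiagIndex r i < 2 * r + 3 := by
  unfold offDiagIndex
  split_ifs <;> omega

theorem offDiagIndex_ne {r i : ℕ} : offDiagIndex r i ≠ i := by
  unfold offDiagIndex
  split_ifs <;> omega

open Matrix in
theorem Matrix.sum_sum_inv_eq {n K : Type*} [Fintype n] [DecidableEq n] [Field K]
    {A : Matrix n n K} (hA : A.det ≠ 0) {q : n → K} {D : K} (hD : D ≠ 0)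
    (hq : A *ᵥ q = fun _ => D) : ∑ i, ∑ j, A⁻¹ i j = (∑ i, q i) / D := by
  have h : q = A⁻¹ *ᵥ (fun _ => D) := by
    rw [← hq, Matrix.mulVec_mulVec, Matrix.nonsing_inv_mul A hA.isUnit, Matrix.one_mulVec]
  rw [h, eq_div_iff hD]
  simp only [Matrix.mulVec, dotProduct, Finset.sum_mul]

/-- The odd-dimensional case of Lemma 7.1 of Esser–Totaro: the exponent matrix `A`
of the large-index hypersurface `V′` of dimension `n = 2r+1` (diagonal entries
`b_0, …, b_{2r}, b′, v′` with `2b′ = 1 + b_1⋯b_{2r} + 2t_1` and `v′ = g_1 + w_1`,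
together with `A_{i,2r+2−i} = 1` for `0 ≤ i ≤ r`, `A_{r+1+i,r−i} = 1` for
`0 ≤ i ≤ r`, and `A_{2r+2,r+1} = 1`) is invertible over `ℚ` and the sum of all
entries of `A⁻¹` equals 1, i.e. `V′` is Calabi–Yau. -/
theorem large_index_hypersurface_is_calabi_yau (r : ℕ) (hr : 1 ≤ r) (b' : ℤ)
    (hb : 2 * b' = 1 + (∏ j ∈ Finset.Icc 1 (2 * r), bexp r j) + 2 * tB r 1)
    (A : Matrix (Fin (2 * r + 3)) (Fin (2 * r + 3)) ℚ)
    (hA : ∀ i j : Fin (2 * r + 3),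
      A i j =
        if i = j then
          (if i.val ≤ 2 * r then (bexp r i.val : ℚ)
           else if i.val = 2 * r + 1 then (b' : ℚ)
           else ((gB r 1 + wB r 1 : ℤ) : ℚ))
        else if i.val ≤ r ∧ i.val + j.val = 2 * r + 2 then 1
        else if r + 1 ≤ i.val ∧ i.val ≤ 2 * r + 1 ∧ i.val + j.val = 2 * r + 1 then 1
        else if i.val = 2 * r + 2 ∧ j.val = r + 1 then 1
        else 0) :
    A.det ≠ 0 ∧ ∑ i, ∑ j, A⁻¹ i j = 1 := by
  rw [prod_Icc_bexp] at hb
  set v := gB r 1 + wB r 1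
  let nxt : Fin (2 * r + 3) → Fin (2 * r + 3) := fun i => ⟨offDiagIndex r i, offDiagIndex_lt⟩
  have hnxt (i) : nxt i ≠ i := fun h => offDiagIndex_ne (congrArg Fin.val h)
  have hdiag (i : Fin (2 * r + 3)) : A i i = diagExp r b' v i := by
    rw [hA, if_pos rfl, diagExp]
    split_ifs <;> rfl
  have hoff (i j : Fin (2 * r + 3)) (hij : i ≠ j) : A i j = if j = nxt i then 1 else 0 := by
    have hi := i.isLt
    have hj := j.isLt
    rw [hA, if_neg hij]
    simp only [nxt, Fin.ext_iff, offDiagIndex]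
    split_ifs <;> first | rfl | omega
  have hdet : A.det ≠ 0 := by
    refine det_ne_zero_of_sum_row_lt_diag fun i => ?_
    have hn : ‖(diagExp r b' v i : ℚ)‖ = ((diagExp r b' v i : ℤ) : ℝ) := by
      rw [← Rat.norm_cast_real, Real.norm_eq_abs, Rat.cast_intCast, abs_of_nonneg]
      exact_mod_cast zero_le_two.trans (two_le_diagExp hb i)
    have h2 : (2 : ℝ) ≤ (diagExp r b' v i : ℤ) := by exact_mod_cast two_le_diagExp hb i
    rw [Finset.sum_congr rfl fun j hj => by rw [hoff i j (Finset.ne_of_mem_erase hj).symm],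
      Finset.sum_eq_single_of_mem (nxt i) (by simp [hnxt])
        (fun j _ hj => by simp [hj]), hdiag, if_pos rfl, norm_one, hn]
    linarith
  refine ⟨hdet, ?_⟩
  have hD : ((2 * b' - 1 : ℤ) : ℚ) ≠ 0 := by
    exact_mod_cast (by omega : 2 * b' - 1 ≠ 0)
  rw [Matrix.sum_sum_inv_eq hdet (q := fun j => (cyWeight r b' v j : ℚ)) hD]
  · rw [Fin.sum_univ_eq_sum_range (fun j => (cyWeight r b' v j : ℚ)), ← Int.cast_sum,
      sum_cyWeight hb hr, div_self hD]
  · funext i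
    rw [Matrix.mulVec, dotProduct, ← Finset.add_sum_erase _ _ (Finset.mem_univ i),
      Finset.sum_congr rfl fun j hj => by rw [hoff i j (Finset.ne_of_mem_erase hj).symm],
      Finset.sum_eq_single_of_mem (nxt i) (by simp [hnxt]) (fun j _ hj => by simp [hj]), hdiag,
      if_pos rfl, one_mul]
    exact_mod_cast diagExp_mul_cyWeight_add hb hr i.isLt
end
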